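/- Let Q, L, J, W^mc be as in the context and let L̂ be the free ℤ-module on C := {c_a : a ∈ J ∪ Q₀^leg} with the bilinear form given there, and Ξ: L̂ → L the canonical map. Then Ξ is an isometry, i.e. (γ,γ') = (Ξ(γ),Ξ(γ')) for all γ, γ' ∈ L̂, and Ξ is W^mc-equivariant, i.e. Ξ(s_a(γ)) = s_a(Ξ(γ)) for every γ ∈ L̂ and every a ∈ J ∪ Q₀^leg (where s_a acts on L̂ as the simple reflection in c_a and on L ⊆ ℤ^{Q₀} as s_i resp. s_{[i,j,k]}). -/

import Mathlib

/-!
STATEMENT 17: the canonical map `Ξ : L̂ → L` from the Kac–Moody root lattice `L̂`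
(free on `C = {c_a : a ∈ J ∪ Q₀^leg}` with the prescribed bilinear form) is an isometry
and is `W^mc`-equivariant.
-/
open Matrix BigOperators

noncomputable section

/-! ### Formal Laurent series preliminaries -/

/-- Evaluation of a polynomial at `z⁻¹`. -/
def polyZinv (q : Polynomial ℂ) : LaurentSeries ℂ :=
  q.sum fun k c => HahnSeries.single (-(k : ℤ)) c

/-- A Laurent series lies in `ℂ[[z]]`. -/
def Tame (f : LaurentSeries ℂ) : Prop := ∀ k : ℤ, k < 0 → f.coeff k = 0

/-- A Laurent series is a principal part (class representative in `ℂ((z))/ℂ[[z]]`). -/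
def IsPrincipal (f : LaurentSeries ℂ) : Prop := ∀ k : ℤ, 0 ≤ k → f.coeff k = 0

/-- `GL(n, ℂ[[z]])`. -/
abbrev GLps (n : ℕ) := (Matrix (Fin n) (Fin n) (PowerSeries ℂ))ˣ

/-- `GL(n, ℂ)`. -/
abbrev GLc (n : ℕ) := (Matrix (Fin n) (Fin n) ℂ)ˣ

/-- The inclusion `GL(n, ℂ[[z]]) → GL(n, ℂ((z)))`. -/
def glMap {n : ℕ} : GLps n →* (Matrix (Fin n) (Fin n) (LaurentSeries ℂ))ˣ :=
  Units.map ((HahnSeries.ofPowerSeries ℤ ℂ).mapMatrix).toMonoidHom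

/-- The inclusion `GL(n, ℂ) → GL(n, ℂ((z)))`. -/
def glC {n : ℕ} : GLc n →* (Matrix (Fin n) (Fin n) (LaurentSeries ℂ))ˣ :=
  Units.map ((HahnSeries.C : ℂ →+* LaurentSeries ℂ).mapMatrix).toMonoidHom

/-- Conjugation of a matrix of Laurent series by `X ∈ GL(n, ℂ[[z]])`. -/
def conjPS {n : ℕ} (X : GLps n) (B : Matrix (Fin n) (Fin n) (LaurentSeries ℂ)) :
    Matrix (Fin n) (Fin n) (LaurentSeries ℂ) :=
  (glMap X).val * B * ((glMap X)⁻¹).val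

/-- Conjugation by a constant invertible matrix. -/
def conjC {n : ℕ} (g : GLc n) (B : Matrix (Fin n) (Fin n) (LaurentSeries ℂ)) :
    Matrix (Fin n) (Fin n) (LaurentSeries ℂ) :=
  (glC g).val * B * ((glC g)⁻¹).val

/-- The matrix of `z^k`-coefficients of a matrix of Laurent series. -/
def coeffM {n : ℕ} (M : Matrix (Fin n) (Fin n) (LaurentSeries ℂ)) (k : ℤ) :
    Matrix (Fin n) (Fin n) ℂ := fun a b => (M a b).coeff k

/-! ### Finite quivers and representations of double quivers -/

/-- A finite quiver. -/
structure FinQuiver where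
  V : Type
  E : Type
  [fintypeV : Fintype V]
  [decEqV : DecidableEq V]
  [fintypeE : Fintype E]
  [decEqE : DecidableEq E]
  src : E → V
  tgt : E → V

attribute [instance] FinQuiver.fintypeV FinQuiver.decEqV FinQuiver.fintypeE FinQuiver.decEqE

namespace FinQuiver

variable (Q : FinQuiver) (α : Q.V → ℕ)

/-- The representation space of the double quiver `Q̄` with dimension vector `α`. -/
abbrev Rep :=
  ∀ e : Q.E, Matrix (Fin (α (Q.tgt e))) (Fin (α (Q.src e))) ℂ ×
    Matrix (Fin (α (Q.src e))) (Fin (α (Q.tgt e))) ℂ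

/-- The group `G = ∏_{a ∈ Q₀} GL(α_a, ℂ)`. -/
abbrev GGroup := ∀ a : Q.V, (Matrix (Fin (α a)) (Fin (α a)) ℂ)ˣ

variable {Q α}

/-- The action of `G` on `Rep(Q̄,α)`. -/
def act (g : Q.GGroup α) (x : Q.Rep α) : Q.Rep α := fun e =>
  ((g (Q.tgt e)).val * (x e).1 * ((g (Q.src e))⁻¹).val,
   (g (Q.src e)).val * (x e).2 * ((g (Q.tgt e))⁻¹).val)

/-- The moment map `μ`. -/
def mu (x : Q.Rep α) (a : Q.V) : Matrix (Fin (α a)) (Fin (α a)) ℂ :=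
  (∑ e : Q.E, if h : Q.tgt e = a then
      (Matrix.reindex (finCongr (congrArg α h)) (finCongr (congrArg α h))
        ((x e).1 * (x e).2)) else 0)
  - ∑ e : Q.E, if h : Q.src e = a then
      (Matrix.reindex (finCongr (congrArg α h)) (finCongr (congrArg α h))
        ((x e).2 * (x e).1)) else 0

/-- A collection of subspaces invariant under all the components of `x`. -/
def InvFamily (x : Q.Rep α) (W : ∀ a : Q.V, Submodule ℂ (Fin (α a) → ℂ)) : Prop :=
  ∀ e : Q.E, (∀ v ∈ W (Q.src e), (x e).1.mulVec v ∈ W (Q.tgt e)) ∧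
             (∀ v ∈ W (Q.tgt e), (x e).2.mulVec v ∈ W (Q.src e))

/-- `x` is an irreducible representation of the double quiver. -/
def Irred (x : Q.Rep α) : Prop :=
  ∀ W : ∀ a : Q.V, Submodule ℂ (Fin (α a) → ℂ),
    InvFamily x W → (∀ a, W a = ⊥) ∨ (∀ a, W a = ⊤)

variable (Q)

/-! ### The root system of a finite quiver -/

/-- The Euler form. -/
def euler (β γ : Q.V → ℤ) : ℤ :=
  (∑ a : Q.V, β a * γ a) - ∑ e : Q.E, β (Q.src e) * γ (Q.tgt e)

/-- The symmetrized Euler form. -/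
def bform (β γ : Q.V → ℤ) : ℤ := euler Q β γ + euler Q γ β

/-- `q(β) = (β,β)/2`. -/
def qform (β : Q.V → ℤ) : ℤ := euler Q β β

/-- `p(β) = 1 − q(β)`. -/
def pform (β : Q.V → ℤ) : ℤ := 1 - qform Q β

/-- A vertex with no edge-loop. -/
def LoopFree (a : Q.V) : Prop := ∀ e : Q.E, ¬(Q.src e = a ∧ Q.tgt e = a)

/-- The coordinate vector at a vertex. -/
def eps (a : Q.V) : Q.V → ℤ := fun b => if b = a then 1 else 0

/-- The fundamental reflection at a vertex. -/
def reflV (a : Q.V) (β : Q.V → ℤ) : Q.V → ℤ := β - bform Q β (eps Q a) • eps Q a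

/-- One reflection step. -/
def reflStep (β γ : Q.V → ℤ) : Prop := ∃ a : Q.V, LoopFree Q a ∧ γ = reflV Q a β

/-- The real roots. -/
def realRoots : Set (Q.V → ℤ) :=
  {β | ∃ a : Q.V, LoopFree Q a ∧ Relation.ReflTransGen (reflStep Q) (eps Q a) β}

/-- The support. -/
def supp (β : Q.V → ℤ) : Set Q.V := {a | β a ≠ 0}

/-- Connectedness of the support of `β` in the underlying graph of `Q`. -/
def ConnSupport (β : Q.V → ℤ) : Prop :=
  ∀ a ∈ supp Q β, ∀ b ∈ supp Q β,
    Relation.ReflTransGen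
      (fun u v => u ∈ supp Q β ∧ v ∈ supp Q β ∧
        ∃ e : Q.E, (Q.src e = u ∧ Q.tgt e = v) ∨ (Q.src e = v ∧ Q.tgt e = u)) a b

/-- The fundamental set. -/
def fundSet : Set (Q.V → ℤ) :=
  {β | β ≠ 0 ∧ (∀ a, 0 ≤ β a) ∧ (∀ a, LoopFree Q a → bform Q β (eps Q a) ≤ 0) ∧
    ConnSupport Q β}

/-- The imaginary roots. -/
def imRoots : Set (Q.V → ℤ) :=
  {β | ∃ γ, (γ ∈ fundSet Q ∨ -γ ∈ fundSet Q) ∧ Relation.ReflTransGen (reflStep Q) γ β}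

/-- The roots. -/
def roots : Set (Q.V → ℤ) := realRoots Q ∪ imRoots Q

/-- The positive roots. -/
def posRoots : Set (Q.V → ℤ) := {β ∈ roots Q | ∀ a, 0 ≤ β a}

/-- `λ·β`. -/
def lamDot (lam : Q.V → ℂ) (β : Q.V → ℤ) : ℂ := ∑ a : Q.V, lam a * (β a : ℂ)

variable {Q}

end FinQuiver

/-! ### The data of a collection of HTL normal forms -/

/-- A collection `B = (B^{(0)}, …, B^{(p)})` of unramified HTL normal forms of size `n`,
`B^{(i)} = diag(q^{(i)}_j(z⁻¹)I_{n^{(i)}_j} + R^{(i)}_j z⁻¹)_{j=1,…,m^{(i)}}`,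
together with eigenvalue data `ξ^{[i,j]}_1, …, ξ^{[i,j]}_{e_{[i,j]}}` with
`∏_k (R^{(i)}_j − ξ^{[i,j]}_k) = 0`. -/
structure ConnData where
  n : ℕ
  hn : 0 < n
  p : ℕ
  m : Fin (p+1) → ℕ
  hm : ∀ i, 0 < m i
  nb : (i : Fin (p+1)) → Fin (m i) → ℕ
  hnb : ∀ i j, 0 < nb i j
  hsum : ∀ i, ∑ j, nb i j = n
  q : (i : Fin (p+1)) → Fin (m i) → Polynomial ℂ
  hq0 : ∀ i j, (q i j).coeff 0 = 0
  hq1 : ∀ i j, (q i j).coeff 1 = 0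
  hqd : ∀ i (j j' : Fin (m i)), j ≠ j' → q i j ≠ q i j'
  hreg : ∀ i, i ≠ 0 → m i = 1 → ∀ j, q i j = 0
  R : (i : Fin (p+1)) → (j : Fin (m i)) → Matrix (Fin (nb i j)) (Fin (nb i j)) ℂ
  e : (i : Fin (p+1)) → Fin (m i) → ℕ
  he : ∀ i j, 0 < e i j
  xi : (i : Fin (p+1)) → (j : Fin (m i)) → Fin (e i j) → ℂ
  hxi : ∀ i j,
    (List.ofFn fun k => R i j - xi i j k • (1 : Matrix (Fin (nb i j)) (Fin (nb i j)) ℂ)).prod = 0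

namespace ConnData

variable (D : ConnData)

/-- `i ∈ I_irr`. -/
def isIrr (i : Fin (D.p+1)) : Prop := 1 < D.m i ∨ i = 0

instance : DecidablePred D.isIrr := fun _ => inferInstanceAs (Decidable (_ ∨ _))

/-- The set of indices of irregular type. -/
abbrev IrrIdx := {i : Fin (D.p+1) // D.isIrr i}

/-- The set of indices of irregular type other than `0`. -/
abbrev IrrNz := {i : Fin (D.p+1) // D.isIrr i ∧ i ≠ 0}

/-- The unique block index at a point. -/
def j1 (i : Fin (D.p+1)) : Fin (D.m i) := ⟨0, D.hm i⟩

/-- `d_i(j,j') = deg(q^{(i)}_j − q^{(i)}_{j'}) − 2`. -/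
def dd (i : Fin (D.p+1)) (j j' : Fin (D.m i)) : ℕ := ((D.q i j) - (D.q i j')).natDegree - 2

/-- The vertex set of the quiver: mid vertices `[i,j]` (for `i ∈ I_irr`) and leg
vertices `[i,j,k]`, `1 ≤ k ≤ e_{[i,j]}−1`. -/
abbrev Vq :=
  (Σ i : D.IrrIdx, Fin (D.m i.1)) ⊕ (Σ i : Fin (D.p+1), Σ j : Fin (D.m i), Fin (D.e i j - 1))

/-- The vertex `[i,j]`, `i ∈ I_irr`. -/
def vmid (i : D.IrrIdx) (j : Fin (D.m i.1)) : D.Vq := Sum.inl ⟨i, j⟩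

/-- `0 ∈ I_irr`. -/
def irr0 : D.IrrIdx := ⟨0, Or.inr rfl⟩

/-- The vertex `[0,j]`. -/
def vmid0 (j : Fin (D.m 0)) : D.Vq := Sum.inl ⟨D.irr0, j⟩

/-- The leg vertex `[i,j,k+1]` (`k` is 0-based). -/
def vleg (i : Fin (D.p+1)) (j : Fin (D.m i)) (k : Fin (D.e i j - 1)) : D.Vq :=
  Sum.inr ⟨i, j, k⟩

/-- Arrows `[0,j] → [i,j']`, `i ∈ I_irr \ {0}`. -/
abbrev Arr1 := Fin (D.m 0) × (Σ i : D.IrrNz, Fin (D.m i.1))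
/-- `d_i(j,j')` arrows `[i,j] → [i,j']` for `i ∈ I_irr`, `j < j'`. -/
abbrev Arr2 := Σ i : D.IrrIdx, Σ jj : {x : Fin (D.m i.1) × Fin (D.m i.1) // x.1 < x.2},
  Fin (D.dd i.1 jj.1.1 jj.1.2)
/-- Leg arrows `[i,j,k] → [i,j,k−1]`, `k ≥ 2`. -/
abbrev Arr3 := Σ i : Fin (D.p+1), Σ j : Fin (D.m i), Fin (D.e i j - 2)
/-- Arrows `[i,j,1] → [i,j]`, `i ∈ I_irr`. -/
abbrev Arr4 := Σ i : D.IrrIdx, {j : Fin (D.m i.1) // 2 ≤ D.e i.1 j}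
/-- Arrows `[i,1,1] → [0,j]`, `i ∈ I_reg`. -/
abbrev Arr5 := {i : Fin (D.p+1) // ¬ D.isIrr i ∧ 2 ≤ D.e i (D.j1 i)} × Fin (D.m 0)

/-- The arrow set of the quiver. -/
abbrev Arr := D.Arr1 ⊕ D.Arr2 ⊕ D.Arr3 ⊕ D.Arr4 ⊕ D.Arr5

/-- Sources of arrows. -/
def qsrc : D.Arr → D.Vq
  | .inl (j, ⟨_, _⟩) => D.vmid0 j
  | .inr (.inl ⟨i, jj, _⟩) => D.vmid i jj.1.1
  | .inr (.inr (.inl ⟨i, j, t⟩)) => D.vleg i j ⟨t.1 + 1, by have := t.isLt; omega⟩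
  | .inr (.inr (.inr (.inl ⟨i, j⟩))) => D.vleg i.1 j.1 ⟨0, by have := j.2; omega⟩
  | .inr (.inr (.inr (.inr (i, _)))) => D.vleg i.1 (D.j1 i.1) ⟨0, by have := i.2.2; omega⟩

/-- Targets of arrows. -/
def qtgt : D.Arr → D.Vq
  | .inl (_, ⟨i, j'⟩) => D.vmid ⟨i.1, i.2.1⟩ j'
  | .inr (.inl ⟨i, jj, _⟩) => D.vmid i jj.1.2
  | .inr (.inr (.inl ⟨i, j, t⟩)) => D.vleg i j ⟨t.1, by have := t.isLt; omega⟩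
  | .inr (.inr (.inr (.inl ⟨i, j⟩))) => D.vmid i j.1
  | .inr (.inr (.inr (.inr (_, j)))) => D.vmid0 j

/-- The quiver `Q` associated with `B`. -/
def quiv : FinQuiver := FinQuiver.mk (V := D.Vq) (E := D.Arr) D.qsrc D.qtgt

/-- The dimension vector `α`. -/
def alphaV : D.Vq → ℕ
  | .inl ⟨i, j⟩ => D.nb i.1 j
  | .inr ⟨i, j, k⟩ =>
      ((List.ofFn fun l : Fin (k.1 + 1) =>
          D.R i j - D.xi i j ⟨l.1, by have := l.isLt; have := k.isLt; omega⟩ •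
            (1 : Matrix (Fin (D.nb i j)) (Fin (D.nb i j)) ℂ)).prod).rank

/-- The dimension vector `α` as an integral vector. -/
def alphaZ : D.Vq → ℤ := fun a => (D.alphaV a : ℤ)

/-- `Σ_{i ∈ I_reg} ξ^{[i,1]}_1`. -/
def regSumXi : ℂ :=
  ∑ i : Fin (D.p+1), if D.isIrr i then 0 else D.xi i (D.j1 i) ⟨0, D.he _ _⟩

/-- The parameter `λ`. -/
def lamV : D.Vq → ℂ
  | .inl ⟨⟨i, _⟩, j⟩ =>
      if h : i = 0 then - D.xi 0 (h ▸ j) ⟨0, D.he _ _⟩ - D.regSumXi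
      else - D.xi i j ⟨0, D.he _ _⟩
  | .inr ⟨i, j, k⟩ =>
      D.xi i j ⟨k.1, by have := k.isLt; omega⟩ - D.xi i j ⟨k.1 + 1, by have := k.isLt; omega⟩

/-- The lattice `L ⊆ ℤ^{Q₀}`. -/
def latt : Set (D.Vq → ℤ) :=
  {β | ∀ i : D.IrrNz,
    (∑ j : Fin (D.m 0), β (D.vmid0 j)) = ∑ j : Fin (D.m i.1), β (D.vmid ⟨i.1, i.2.1⟩ j)}

/-- `L`-irreducibility of a representation: no nontrivial proper invariant collection
of subspaces whose dimension vector lies in `L`. -/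
def LIrred {αd : D.Vq → ℕ} (x : D.quiv.Rep αd) : Prop :=
  ∀ W : ∀ a : D.Vq, Submodule ℂ (Fin (αd a) → ℂ),
    FinQuiver.InvFamily x W →
    (fun a => (Module.finrank ℂ (W a) : ℤ)) ∈ D.latt →
    (∀ a, W a = ⊥) ∨ (∀ a, W a = ⊤)

/-- The block matrix formed by the components of `x` along the arrows `[0,j] → [i,j']`
for a fixed `i ∈ I_irr \ {0}`. -/
def detMat {αd : D.Vq → ℕ} (x : D.quiv.Rep αd) (i : D.IrrNz) :
    Matrix (Σ j' : Fin (D.m i.1), Fin (αd (D.vmid ⟨i.1, i.2.1⟩ j')))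
      (Σ j : Fin (D.m 0), Fin (αd (D.vmid0 j))) ℂ :=
  fun rc cc => (x (Sum.inl (cc.1, ⟨i, rc.1⟩))).1 rc.2 cc.2

/-- The determinant conditions: the block matrices along the arrows `[0,j] → [i,j']`
are invertible for all `i ∈ I_irr \ {0}`. -/
def DetCond {αd : D.Vq → ℕ} (x : D.quiv.Rep αd) : Prop :=
  ∀ i : D.IrrNz, Function.Bijective (Matrix.mulVecLin (D.detMat x i))

/-- The set underlying `M_λ(Q,α)^dif`. -/
def MdifSub (lam : D.Vq → ℂ) (αd : D.Vq → ℕ) :=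
  {x : D.quiv.Rep αd //
    (∀ a, FinQuiver.mu x a = lam a • (1 : Matrix (Fin (αd a)) (Fin (αd a)) ℂ)) ∧
    D.LIrred x ∧ D.DetCond x}

/-- `M_λ(Q,α)^dif`: the quotient of the `L`-irreducible locus (with the determinant
conditions) of `μ⁻¹(λ)` by `G`. -/
def Mdif (lam : D.Vq → ℂ) (αd : D.Vq → ℕ) :=
  Quot (fun x y : D.MdifSub lam αd => ∃ g : D.quiv.GGroup αd, FinQuiver.act g x.1 = y.1)

/-- Identification of the disjoint union of the blocks of `B^{(i)}` with `Fin n`. -/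
def sigmaEquiv (i : Fin (D.p+1)) : (Σ j : Fin (D.m i), Fin (D.nb i j)) ≃ Fin D.n :=
  Fintype.equivFinOfCardEq (by simpa using D.hsum i)

/-- The matrix of the HTL normal form `B^{(i)}`. -/
def BmatAt (i : Fin (D.p+1)) : Matrix (Fin D.n) (Fin D.n) (LaurentSeries ℂ) :=
  Matrix.reindex (D.sigmaEquiv i) (D.sigmaEquiv i)
    (Matrix.blockDiagonal' fun j =>
      (fun a b => (if a = b then polyZinv (D.q i j) else 0) +
        HahnSeries.single (-1 : ℤ) (D.R i j a b)))

/-- Membership in the moduli space data: a tuple of principal parts, lying in the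
truncated orbits of the `B^{(i)}`, with vanishing total residue, which is
irreducible. -/
def MBMem (A : Fin (D.p+1) → Matrix (Fin D.n) (Fin D.n) (LaurentSeries ℂ)) : Prop :=
  (∀ i a b, IsPrincipal (A i a b)) ∧
  (∀ i, ∃ X : GLps D.n, ∀ a b, Tame ((A i - conjPS X (D.BmatAt i)) a b)) ∧
  (∑ i, coeffM (A i) (-1)) = 0 ∧
  (∀ W : Submodule ℂ (Fin D.n → ℂ),
    (∀ i (k : ℤ), ∀ v ∈ W, (coeffM (A i) k).mulVec v ∈ W) → W = ⊥ ∨ W = ⊤)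

/-- The set underlying the moduli space `M(B)`. -/
def MBSub := {A : Fin (D.p+1) → Matrix (Fin D.n) (Fin D.n) (LaurentSeries ℂ) // D.MBMem A}

/-- The moduli space `M(B)` of stable meromorphic connections on trivial bundles with
formal types `B`: the quotient by simultaneous `GL(n,ℂ)`-conjugation. -/
def MB := Quot (fun A A' : D.MBSub => ∃ g : GLc D.n, ∀ i, conjC g (A.1 i) = A'.1 i)

/-- The index set `J` of tuples `𝐢 = ([i,j_i])_{0 ≤ i ≤ p}`. -/
abbrev Jtype := (i : Fin (D.p+1)) → Fin (D.m i)

/-- The set of leg vertices. -/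
abbrev LegIdx := Σ i : Fin (D.p+1), Σ j : Fin (D.m i), Fin (D.e i j - 1)

/-- The leg vertex as a vertex of the quiver. -/
def legV (a : D.LegIdx) : D.Vq := Sum.inr a

/-- `ε_𝐢 ∈ ℤ^{Q₀}`: entry `1` at `[i,j_i]` for `i ∈ I_irr`, `0` elsewhere. -/
def epsJ (jj : D.Jtype) : D.Vq → ℤ
  | .inl ⟨⟨i, _⟩, j⟩ => if j = jj i then 1 else 0
  | .inr _ => 0

/-- The index set `C = {c_a : a ∈ J ∪ Q₀^leg}` of the generators of `L̂`. -/
abbrev CIdx := D.Jtype ⊕ D.LegIdx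

/-- The value of the bilinear form of `L̂` on two leg generators. -/
def legForm (a a' : D.LegIdx) : ℤ :=
  if h : a.1 = a'.1 then
    (if _h2 : (h ▸ a.2.1) = a'.2.1 then
      (if a.2.2.1 = a'.2.2.1 then 2
       else if a.2.2.1 = a'.2.2.1 + 1 ∨ a'.2.2.1 = a.2.2.1 + 1 then -1 else 0)
     else 0)
  else 0

/-- The bilinear form of `L̂` on the generators:
`(c_𝐢, c_𝐢') = 2 − Σ_{i : j_i ≠ j'_i} (d_i(j_i,j'_i) + 2)`,
`(c_𝐢, c_{[i,j,k]}) = −1` iff `j = j_i` and `k = 1`,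
`(c_{[i,j,k]}, c_{[i',j',k']}) = 2, −1, 0` according to coincidence/adjacency. -/
def genForm : D.CIdx → D.CIdx → ℤ
  | .inl jj, .inl jj' =>
      2 - ∑ i : Fin (D.p+1),
        (if jj i ≠ jj' i then ((D.dd i (jj i) (jj' i) : ℤ) + 2) else 0)
  | .inl jj, .inr a => if a.2.1 = jj a.1 ∧ a.2.2.1 = 0 then -1 else 0
  | .inr a, .inl jj => if a.2.1 = jj a.1 ∧ a.2.2.1 = 0 then -1 else 0
  | .inr a, .inr a' => D.legForm a a'

/-- The symmetric bilinear form of the Kac–Moody root lattice `L̂`. -/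
def hatForm (γ γ' : D.CIdx → ℤ) : ℤ :=
  ∑ c : D.CIdx, ∑ c' : D.CIdx, γ c * γ' c' * D.genForm c c'

/-- The generator `c_a` of `L̂`. -/
def hatGen (c0 : D.CIdx) : D.CIdx → ℤ := fun c => if c = c0 then 1 else 0

/-- The simple reflection of `L̂` in the simple root `c_a`. -/
def hatRefl (c0 : D.CIdx) (γ : D.CIdx → ℤ) : D.CIdx → ℤ :=
  γ - D.hatForm γ (D.hatGen c0) • D.hatGen c0

/-- The canonical map `Ξ : L̂ → L`:
`Ξ(γ)_{[i,j]} = Σ_{𝐢 ∈ J, j_i = j} γ_{c_𝐢}` and `Ξ(γ)_{[i,j,k]} = γ_{c_{[i,j,k]}}`. -/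
def XiMap (γ : D.CIdx → ℤ) : D.Vq → ℤ
  | .inl ⟨⟨i, _⟩, j⟩ => ∑ jj : D.Jtype, (if jj i = j then γ (Sum.inl jj) else 0)
  | .inr a => γ (Sum.inr a)

/-- The reflection `s_𝐢(β) = β − (β,ε_𝐢)ε_𝐢` on `ℤ^{Q₀}`. -/
def sJ (jj : D.Jtype) (β : D.Vq → ℤ) : D.Vq → ℤ :=
  β - FinQuiver.bform D.quiv β (D.epsJ jj) • D.epsJ jj

/-- The action of the generator `s_a`, `a ∈ J ∪ Q₀^leg`, on `ℤ^{Q₀}`: `s_𝐢` for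
`a = 𝐢 ∈ J` and the simple reflection at the leg vertex otherwise. -/
def sDown (c0 : D.CIdx) (β : D.Vq → ℤ) : D.Vq → ℤ :=
  match c0 with
  | .inl jj => D.sJ jj β
  | .inr a => FinQuiver.reflV D.quiv (D.legV a) β

end ConnData

end


namespace FinQuiver

variable (Q : FinQuiver)

lemma sum_apply_mul_sum_apply {V T ι κ : Type*} [Fintype T] [Fintype ι] [Fintype κ]
    (x : ι → ℤ) (y : κ → ℤ) (u : ι → V → ℤ) (v : κ → V → ℤ) (f g : T → V) :
    ∑ t, (∑ c, x c • u c) (f t) * (∑ c', y c' • v c') (g t) =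
      ∑ c, ∑ c', x c * y c' * ∑ t, u c (f t) * v c' (g t) := by
  simp only [Finset.sum_apply, Pi.smul_apply, smul_eq_mul, Finset.sum_mul_sum]
  rw [Finset.sum_comm]
  refine Finset.sum_congr rfl fun c _ => ?_
  rw [Finset.sum_comm]
  simp only [Finset.mul_sum]
  exact Finset.sum_congr rfl fun c' _ => Finset.sum_congr rfl fun t _ => by ring

lemma euler_sum_smul {ι κ : Type*} [Fintype ι] [Fintype κ] (x : ι → ℤ) (y : κ → ℤ)
    (u : ι → Q.V → ℤ) (v : κ → Q.V → ℤ) :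
    euler Q (∑ c, x c • u c) (∑ c', y c' • v c') =
      ∑ c, ∑ c', x c * y c' * euler Q (u c) (v c') := by
  simp only [euler, mul_sub, Finset.sum_sub_distrib]
  rw [sum_apply_mul_sum_apply x y u v (fun a => a) (fun a => a), sum_apply_mul_sum_apply]

lemma bform_sum_smul {ι κ : Type*} [Fintype ι] [Fintype κ] (x : ι → ℤ) (y : κ → ℤ)
    (u : ι → Q.V → ℤ) (v : κ → Q.V → ℤ) :
    bform Q (∑ c, x c • u c) (∑ c', y c' • v c') =
      ∑ c, ∑ c', x c * y c' * bform Q (u c) (v c') := by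
  rw [bform, euler_sum_smul, euler_sum_smul, Finset.sum_comm (s := (Finset.univ : Finset κ))]
  simp only [bform, mul_add, Finset.sum_add_distrib, mul_comm (y _)]

end FinQuiver

namespace ConnData

open FinQuiver

variable (D : ConnData)

/-- The Euler form of the quiver, on integral vectors indexed by `D.Vq`. -/
noncomputable def quivEuler (β γ : D.Vq → ℤ) : ℤ := euler D.quiv β γ

/-- The symmetrized Euler form of the quiver, on integral vectors indexed by `D.Vq`. -/
noncomputable def quivForm (β γ : D.Vq → ℤ) : ℤ := D.quivEuler β γ + D.quivEuler γ β

lemma quivForm_comm (β γ : D.Vq → ℤ) : D.quivForm β γ = D.quivForm γ β := add_comm _ _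

/-- The coordinate vector at a leg vertex. -/
def legEps (a : D.LegIdx) : D.Vq → ℤ
  | .inl _ => 0
  | .inr b => if b = a then 1 else 0

lemma eps_legV (a : D.LegIdx) : eps D.quiv (D.legV a) = D.legEps a := by
  funext v
  rcases v with v | b
  · exact if_neg (by rintro ⟨⟩)
  · change (if (Sum.inr b : D.Vq) = Sum.inr a then (1 : ℤ) else 0) = _
    simp only [Sum.inr.injEq, legEps]

/-- The pairing along the leg arrows between consecutive leg vertices. -/
def innerLegSum (β γ : D.Vq → ℤ) : ℤ :=
  ∑ i, ∑ j, ∑ t : Fin (D.e i j - 2),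
    β (D.vleg i j ⟨t.1 + 1, by have := t.isLt; omega⟩) *
      γ (D.vleg i j ⟨t.1, by have := t.isLt; omega⟩)

lemma quivEuler_eq (β γ : D.Vq → ℤ) :
    D.quivEuler β γ =
      ((∑ i : D.IrrIdx, ∑ j, β (D.vmid i j) * γ (D.vmid i j)) + ∑ a, β (D.legV a) * γ (D.legV a))
      - ((∑ j, ∑ i : D.IrrNz, ∑ j', β (D.vmid0 j) * γ (D.vmid ⟨i.1, i.2.1⟩ j'))
        + ((∑ i : D.IrrIdx, ∑ jj : {x : Fin (D.m i.1) × Fin (D.m i.1) // x.1 < x.2},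
              (D.dd i.1 jj.1.1 jj.1.2 : ℤ) * (β (D.vmid i jj.1.1) * γ (D.vmid i jj.1.2)))
          + (innerLegSum D β γ
            + ((∑ i : D.IrrIdx, ∑ j : {j : Fin (D.m i.1) // 2 ≤ D.e i.1 j},
                  β (D.vleg i.1 j.1 ⟨0, by have := j.2; omega⟩) * γ (D.vmid i j.1))
              + ∑ i : {i : Fin (D.p+1) // ¬ D.isIrr i ∧ 2 ≤ D.e i (D.j1 i)}, ∑ j,
                  β (D.vleg i.1 (D.j1 i.1) ⟨0, by have := i.2.2; omega⟩) * γ (D.vmid0 j))))) := by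
  unfold innerLegSum
  change (∑ a : D.Vq, β a * γ a) - ∑ e : D.Arr, β (D.qsrc e) * γ (D.qtgt e) = _
  simp only [Fintype.sum_sum_type, Fintype.sum_sigma, Fintype.sum_prod_type, qsrc, qtgt]
  refine congrArg₂ _ rfl (congrArg₂ _ rfl (congrArg₂ _ ?_ rfl))
  refine Finset.sum_congr rfl fun i _ => Finset.sum_congr rfl fun jj _ => ?_
  exact (Finset.sum_const (β (D.vmid i jj.1.1) * γ (D.vmid i jj.1.2))).trans
    (by rw [Finset.card_univ, Fintype.card_fin, nsmul_eq_mul])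

lemma dd_comm (i : Fin (D.p+1)) (j j' : Fin (D.m i)) : D.dd i j j' = D.dd i j' j := by
  rw [dd, dd, Polynomial.natDegree_sub]

@[simp] lemma epsJ_vmid (jj : D.Jtype) (i : D.IrrIdx) (j : Fin (D.m i.1)) :
    D.epsJ jj (D.vmid i j) = if j = jj i.1 then 1 else 0 := rfl

@[simp] lemma epsJ_vmid0 (jj : D.Jtype) (j : Fin (D.m 0)) :
    D.epsJ jj (D.vmid0 j) = if j = jj 0 then 1 else 0 := rfl

@[simp] lemma epsJ_vleg (jj : D.Jtype) (i : Fin (D.p+1)) (j : Fin (D.m i))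
    (k : Fin (D.e i j - 1)) : D.epsJ jj (D.vleg i j k) = 0 := rfl

@[simp] lemma epsJ_legV (jj : D.Jtype) (a : D.LegIdx) : D.epsJ jj (D.legV a) = 0 := rfl

@[simp] lemma legEps_vmid (a : D.LegIdx) (i : D.IrrIdx) (j : Fin (D.m i.1)) :
    D.legEps a (D.vmid i j) = 0 := rfl

@[simp] lemma legEps_vmid0 (a : D.LegIdx) (j : Fin (D.m 0)) :
    D.legEps a (D.vmid0 j) = 0 := rfl

@[simp] lemma legEps_legV (a b : D.LegIdx) :
    D.legEps a (D.legV b) = if b = a then 1 else 0 := rfl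

@[simp] lemma legEps_vleg (a : D.LegIdx) (i : Fin (D.p+1)) (j : Fin (D.m i))
    (k : Fin (D.e i j - 1)) :
    D.legEps a (D.vleg i j k) = if (⟨i, j, k⟩ : D.LegIdx) = a then 1 else 0 :=
  D.legEps_legV a ⟨i, j, k⟩

lemma sum_irrIdx (f : Fin (D.p+1) → ℤ) :
    ∑ i : D.IrrIdx, f i.1 = ∑ i, if D.isIrr i then f i else 0 := by
  rw [← Finset.sum_filter]
  exact (Finset.sum_subtype _ (by simp) f).symm

lemma sum_irrNz_add (f : Fin (D.p+1) → ℤ) :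
    ∑ i : D.IrrNz, f i.1 + f 0 = ∑ i : D.IrrIdx, f i.1 := by
  have h : ∑ i : D.IrrNz, f i.1 = ∑ i, if D.isIrr i ∧ i ≠ 0 then f i else 0 := by
    rw [← Finset.sum_filter]
    exact (Finset.sum_subtype _ (by simp) f).symm
  have h0 : f 0 = ∑ i : Fin (D.p+1), if i = 0 then f i else 0 := by simp
  rw [h, h0, sum_irrIdx, ← Finset.sum_add_distrib]
  refine Finset.sum_congr rfl fun i _ => ?_
  by_cases hi : i = 0
  · simp [hi, isIrr]
  · simp [hi]

lemma subsingleton_of_not_isIrr {i : Fin (D.p+1)} (h : ¬ D.isIrr i) :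
    Subsingleton (Fin (D.m i)) := by
  rw [Fin.subsingleton_iff_le_one]
  simp only [isIrr, not_or] at h
  omega

lemma quivEuler_epsJ_epsJ (jj jj' : D.Jtype) :
    D.quivEuler (D.epsJ jj) (D.epsJ jj') =
      1 + ∑ i : D.IrrIdx, ((if jj i.1 = jj' i.1 then 1 else 0) - 1
        - if jj i.1 < jj' i.1 then (D.dd i.1 (jj i.1) (jj' i.1) : ℤ) else 0) := by
  rw [quivEuler_eq]
  have hpair : ∀ i : D.IrrIdx,
      (∑ x : {x : Fin (D.m i.1) × Fin (D.m i.1) // x.1 < x.2}, (D.dd i.1 x.1.1 x.1.2 : ℤ) *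
        ((if x.1.1 = jj i.1 then 1 else 0) * (if x.1.2 = jj' i.1 then 1 else 0))) =
      if jj i.1 < jj' i.1 then (D.dd i.1 (jj i.1) (jj' i.1) : ℤ) else 0 := by
    intro i
    rw [← Finset.sum_subtype (Finset.univ.filter fun x : Fin (D.m i.1) × Fin (D.m i.1) =>
      x.1 < x.2) (by simp) fun x => (D.dd i.1 x.1 x.2 : ℤ) *
        ((if x.1 = jj i.1 then 1 else 0) * (if x.2 = jj' i.1 then 1 else 0)),
      Finset.sum_filter, Finset.sum_eq_single (jj i.1, jj' i.1)]
    · simp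
    · rintro ⟨a, b⟩ - h
      by_cases ha : a = jj i.1 <;> by_cases hb : b = jj' i.1 <;> simp_all
    · simp
  have hnz := D.sum_irrNz_add fun _ => 1
  simp only [epsJ_vmid, epsJ_vmid0, epsJ_vleg, epsJ_legV, hpair, innerLegSum, Finset.sum_sub_distrib]
  simp only [ite_mul, one_mul, mul_zero, zero_mul, Finset.sum_const_zero, Finset.sum_ite_irrel,
    Finset.sum_ite_eq', Finset.mem_univ, if_true]
  linarith

lemma quivForm_epsJ_epsJ (jj jj' : D.Jtype) :
    D.quivForm (D.epsJ jj) (D.epsJ jj') = D.genForm (Sum.inl jj) (Sum.inl jj') := by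
  have hirr : ∑ i : Fin (D.p+1), (if jj i ≠ jj' i then ((D.dd i (jj i) (jj' i) : ℤ) + 2) else 0) =
      ∑ i : D.IrrIdx, if jj i.1 ≠ jj' i.1 then ((D.dd i.1 (jj i.1) (jj' i.1) : ℤ) + 2) else 0 := by
    rw [D.sum_irrIdx fun i => if jj i ≠ jj' i then ((D.dd i (jj i) (jj' i) : ℤ) + 2) else 0]
    refine Finset.sum_congr rfl fun i _ => ?_
    by_cases h : D.isIrr i
    · rw [if_pos h]
    · have := D.subsingleton_of_not_isIrr h
      simp [Subsingleton.elim (jj i) (jj' i)]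
  rw [quivForm, quivEuler_epsJ_epsJ, quivEuler_epsJ_epsJ, genForm, hirr, add_add_add_comm,
    ← Finset.sum_add_distrib, sub_eq_add_neg, ← Finset.sum_neg_distrib]
  congr 1
  refine Finset.sum_congr rfl fun i _ => ?_
  rw [D.dd_comm i.1 (jj' i.1)]
  rcases lt_trichotomy (jj i.1) (jj' i.1) with h | h | h
  · simp only [h, h.ne, h.ne', h.not_gt, ne_eq, if_true, if_false, not_false_eq_true]; ring
  · simp [h]
  · simp only [h, h.ne, h.ne', h.not_gt, ne_eq, if_true, if_false, not_false_eq_true]; ring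

/-- The value of `β` at `[i,j,1]`, or `0` if there is no such vertex. -/
def firstLegVal (β : D.Vq → ℤ) (i : Fin (D.p+1)) (j : Fin (D.m i)) : ℤ :=
  if h : 2 ≤ D.e i j then β (D.vleg i j ⟨0, by omega⟩) else 0

lemma firstLegVal_legEps (a : D.LegIdx) (i : Fin (D.p+1)) (j : Fin (D.m i)) :
    D.firstLegVal (D.legEps a) i j =
      if (⟨i, j⟩ : Σ i, Fin (D.m i)) = ⟨a.1, a.2.1⟩ ∧ a.2.2.1 = 0 then 1 else 0 := by
  obtain ⟨i', j', k⟩ := a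
  rw [firstLegVal]
  by_cases hij : (⟨i, j⟩ : Σ i, Fin (D.m i)) = ⟨i', j'⟩
  · cases hij
    have := k.isLt
    rw [dif_pos (by omega)]
    simp [Fin.ext_iff, eq_comm]
  · rw [if_neg (fun h => hij h.1)]
    split_ifs
    · rw [legEps_vleg, if_neg]
      intro h
      cases h
      exact hij rfl
    · rfl

lemma quivForm_epsJ_leg (jj : D.Jtype) (a : D.LegIdx) :
    D.quivForm (D.epsJ jj) (D.legEps a) = D.genForm (Sum.inl jj) (Sum.inr a) := by
  set β := D.legEps a with hβ
  have h1 : D.quivEuler (D.epsJ jj) β = 0 := by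
    rw [quivEuler_eq]
    simp [hβ, innerLegSum]
  have hirr : ∀ i : D.IrrIdx, (∑ j : {j : Fin (D.m i.1) // 2 ≤ D.e i.1 j},
      β (D.vleg i.1 j.1 ⟨0, by have := j.2; omega⟩) * D.epsJ jj (D.vmid i j.1)) =
        D.firstLegVal β i.1 (jj i.1) := by
    intro i
    have : ∀ j : {j : Fin (D.m i.1) // 2 ≤ D.e i.1 j},
        β (D.vleg i.1 j.1 ⟨0, by have := j.2; omega⟩) * D.epsJ jj (D.vmid i j.1) =
          D.firstLegVal β i.1 j.1 * if j.1 = jj i.1 then 1 else 0 := by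
      intro j
      rw [firstLegVal, dif_pos j.2, epsJ_vmid]
    rw [Finset.sum_congr rfl fun j _ => this j,
      ← Finset.sum_subtype (Finset.univ.filter fun j => 2 ≤ D.e i.1 j) (by simp)
        fun j => D.firstLegVal β i.1 j * if j = jj i.1 then 1 else 0, Finset.sum_filter]
    simp only [mul_ite, mul_one, mul_zero, ← ite_and]
    rw [Finset.sum_eq_single (jj i.1)]
    · by_cases h : 2 ≤ D.e i.1 (jj i.1) <;> simp [h, firstLegVal]
    · intro j _ hj
      simp [hj]
    · simp
  have hreg : (∑ i : {i : Fin (D.p+1) // ¬ D.isIrr i ∧ 2 ≤ D.e i (D.j1 i)}, ∑ j,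
      β (D.vleg i.1 (D.j1 i.1) ⟨0, by have := i.2.2; omega⟩) * D.epsJ jj (D.vmid0 j)) =
        ∑ i, if D.isIrr i then 0 else D.firstLegVal β i (jj i) := by
    have : ∀ i : {i : Fin (D.p+1) // ¬ D.isIrr i ∧ 2 ≤ D.e i (D.j1 i)},
        (∑ j, β (D.vleg i.1 (D.j1 i.1) ⟨0, by have := i.2.2; omega⟩) * D.epsJ jj (D.vmid0 j)) =
          D.firstLegVal β i.1 (D.j1 i.1) := by
      intro i
      rw [firstLegVal, dif_pos i.2.2]
      simp
    rw [Finset.sum_congr rfl fun i _ => this i,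
      ← Finset.sum_subtype (Finset.univ.filter fun i => ¬ D.isIrr i ∧ 2 ≤ D.e i (D.j1 i)) (by simp)
        fun i => D.firstLegVal β i (D.j1 i), Finset.sum_filter]
    refine Finset.sum_congr rfl fun i _ => ?_
    by_cases h : D.isIrr i
    · simp [h]
    · have := D.subsingleton_of_not_isIrr h
      rw [Subsingleton.elim (jj i) (D.j1 i)]
      by_cases h2 : 2 ≤ D.e i (D.j1 i) <;> simp [h, h2, firstLegVal]
  have h2 : D.quivEuler β (D.epsJ jj) = -∑ i, D.firstLegVal β i (jj i) := by
    rw [quivEuler_eq, hreg, Finset.sum_congr rfl fun i _ => hirr i,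
      D.sum_irrIdx fun i => D.firstLegVal β i (jj i), ← Finset.sum_add_distrib]
    have : ∀ i, ((if D.isIrr i then D.firstLegVal β i (jj i) else 0) +
        if D.isIrr i then 0 else D.firstLegVal β i (jj i)) = D.firstLegVal β i (jj i) := by
      intro i
      split_ifs <;> simp
    simp only [this]
    simp [hβ, innerLegSum]
  rw [quivForm, h1, h2, zero_add, genForm, Finset.sum_eq_single a.1]
  · rw [hβ, firstLegVal_legEps]
    simp only [Sigma.mk.injEq, heq_eq_eq, true_and, eq_comm (a := jj a.1)]
    split_ifs <;> rfl
  · intro i _ hi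
    rw [hβ, firstLegVal_legEps, if_neg]
    rintro ⟨h, -⟩
    exact hi (congrArg Sigma.fst h)
  · simp

lemma innerLegSum_legEps_of_ne (a b : D.LegIdx)
    (h : (⟨a.1, a.2.1⟩ : Σ i, Fin (D.m i)) ≠ ⟨b.1, b.2.1⟩) :
    innerLegSum D (D.legEps a) (D.legEps b) = 0 := by
  refine Finset.sum_eq_zero fun i _ => Finset.sum_eq_zero fun j _ =>
    Finset.sum_eq_zero fun t _ => ?_
  rw [legEps_vleg, legEps_vleg]
  split_ifs with h1 h2
  · subst h1
    subst h2
    exact absurd rfl h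
  all_goals simp

lemma innerLegSum_legEps (i : Fin (D.p+1)) (j : Fin (D.m i)) (k k' : Fin (D.e i j - 1)) :
    innerLegSum D (D.legEps ⟨i, j, k⟩) (D.legEps ⟨i, j, k'⟩) =
      if k.1 = k'.1 + 1 then 1 else 0 := by
  have hne : ∀ (i' : Fin (D.p+1)) (j' : Fin (D.m i')) (l : Fin (D.e i' j' - 1)),
      (⟨i', j'⟩ : Σ i, Fin (D.m i)) ≠ ⟨i, j⟩ → (⟨i', j', l⟩ : D.LegIdx) ≠ ⟨i, j, k⟩ := by
    intro i' j' l h h'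
    cases h'
    exact h rfl
  rw [innerLegSum, Finset.sum_eq_single i, Finset.sum_eq_single j]
  · simp only [legEps_vleg, Sigma.mk.injEq, heq_eq_eq, true_and, Fin.ext_iff]
    split_ifs with h
    · have := k.isLt
      rw [Finset.sum_eq_single ⟨k'.1, by omega⟩]
      · simp [h]
      · intro t _ ht
        have : t.1 ≠ k'.1 := fun h => ht (Fin.ext h)
        simp [this]
      · simp
    · refine Finset.sum_eq_zero fun t _ => ?_
      split_ifs <;> omega
  · intro j' _ hj
    refine Finset.sum_eq_zero fun t _ => ?_
    rw [legEps_vleg, if_neg (hne _ _ _ (by simpa using hj)), zero_mul]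
  · simp
  · intro i' _ hi
    refine Finset.sum_eq_zero fun j' _ => Finset.sum_eq_zero fun t _ => ?_
    rw [legEps_vleg, if_neg (hne _ _ _ fun h => hi (congrArg Sigma.fst h)), zero_mul]
  · simp

lemma quivEuler_leg_leg (a b : D.LegIdx) :
    D.quivEuler (D.legEps a) (D.legEps b) =
      (if a = b then 1 else 0) -
        innerLegSum D (D.legEps a) (D.legEps b) := by
  rw [quivEuler_eq]
  simp only [legEps_vmid, legEps_vmid0, legEps_legV, mul_zero,
    Finset.sum_const_zero, zero_add, add_zero]
  simp [eq_comm]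

lemma quivForm_leg_leg (a b : D.LegIdx) :
    D.quivForm (D.legEps a) (D.legEps b) =
      D.genForm (Sum.inr a) (Sum.inr b) := by
  rw [quivForm, quivEuler_leg_leg, quivEuler_leg_leg, genForm]
  obtain ⟨i, j, k⟩ := a
  obtain ⟨i', j', k'⟩ := b
  by_cases h : (⟨i, j⟩ : Σ i, Fin (D.m i)) = ⟨i', j'⟩
  · cases h
    simp only [innerLegSum_legEps, legForm, Sigma.mk.injEq, heq_eq_eq, true_and, Fin.ext_iff,
      dite_true]
    split_ifs <;> omega
  · have hne : (⟨i, j, k⟩ : D.LegIdx) ≠ ⟨i', j', k'⟩ := by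
      intro h'
      cases h'
      exact h rfl
    rw [innerLegSum_legEps_of_ne D ⟨i, j, k⟩ ⟨i', j', k'⟩ h,
      innerLegSum_legEps_of_ne D ⟨i', j', k'⟩ ⟨i, j, k⟩ (Ne.symm h), if_neg hne,
      if_neg hne.symm, legForm]
    split_ifs with h1 h2 <;> try rfl
    all_goals
      dsimp only at h1
      subst h1
      exact absurd (by simpa using h2) h

@[simp] lemma XiMap_vmid (γ : D.CIdx → ℤ) (i : D.IrrIdx) (j : Fin (D.m i.1)) :
    D.XiMap γ (Sum.inl ⟨i, j⟩) = ∑ jj : D.Jtype, if jj i.1 = j then γ (Sum.inl jj) else 0 := rfl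

@[simp] lemma XiMap_leg (γ : D.CIdx → ℤ) (a : D.LegIdx) :
    D.XiMap γ (Sum.inr a) = γ (Sum.inr a) := rfl

lemma XiMap_sub_smul (γ δ : D.CIdx → ℤ) (n : ℤ) :
    D.XiMap (γ - n • δ) = D.XiMap γ - n • D.XiMap δ := by
  funext v
  rcases v with ⟨i, j⟩ | a
  · simp only [XiMap_vmid, Pi.sub_apply, Pi.smul_apply, smul_eq_mul, Finset.mul_sum,
      ← Finset.sum_sub_distrib]
    refine Finset.sum_congr rfl fun jj _ => ?_
    split_ifs <;> simp
  · rfl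

lemma XiMap_hatGen_inl (jj : D.Jtype) : D.XiMap (D.hatGen (Sum.inl jj)) = D.epsJ jj := by
  funext v
  rcases v with ⟨i, j⟩ | a
  · change _ = if j = jj i.1 then (1 : ℤ) else 0
    rw [XiMap_vmid, Finset.sum_eq_single jj]
    · simp [hatGen, eq_comm]
    · intro jj' _ h
      simp [hatGen, h]
    · simp
  · simp [hatGen, epsJ]

lemma XiMap_hatGen_inr (a : D.LegIdx) :
    D.XiMap (D.hatGen (Sum.inr a)) = D.legEps a := by
  funext v
  rcases v with ⟨i, j⟩ | b
  · rw [XiMap_vmid]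
    exact (Finset.sum_eq_zero fun jj _ => by simp [hatGen]).trans (D.legEps_vmid a i j).symm
  · refine Eq.trans ?_ (D.legEps_legV a b).symm
    simp [hatGen]

lemma XiMap_eq_sum (γ : D.CIdx → ℤ) :
    D.XiMap γ = ∑ c, γ c • D.XiMap (D.hatGen c) := by
  funext v
  rw [Finset.sum_apply]
  rcases v with ⟨i, j⟩ | a
  · simp only [Pi.smul_apply, smul_eq_mul, Fintype.sum_sum_type, XiMap_hatGen_inl,
      XiMap_hatGen_inr]
    have h : ∀ a : D.LegIdx, D.legEps a (Sum.inl ⟨i, j⟩) = 0 :=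
      fun a => D.legEps_vmid a i j
    simp [h, epsJ, eq_comm]
  · simp [hatGen]

lemma quivForm_XiMap_hatGen (c c' : D.CIdx) :
    D.quivForm (D.XiMap (D.hatGen c)) (D.XiMap (D.hatGen c')) = D.genForm c c' := by
  rcases c with jj | a <;> rcases c' with jj' | a' <;>
    simp only [XiMap_hatGen_inl, XiMap_hatGen_inr]
  · exact D.quivForm_epsJ_epsJ jj jj'
  · exact D.quivForm_epsJ_leg jj a'
  · rw [quivForm_comm]
    exact D.quivForm_epsJ_leg jj' a
  · exact D.quivForm_leg_leg a a'

lemma hatForm_eq_quivForm_XiMap (γ γ' : D.CIdx → ℤ) :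
    D.hatForm γ γ' = D.quivForm (D.XiMap γ) (D.XiMap γ') := by
  rw [D.XiMap_eq_sum γ, D.XiMap_eq_sum γ']
  refine Eq.trans ?_ (FinQuiver.bform_sum_smul D.quiv γ γ' _ _).symm
  exact Finset.sum_congr rfl fun c _ => Finset.sum_congr rfl fun c' _ =>
    congrArg _ (D.quivForm_XiMap_hatGen c c').symm

end ConnData

open ConnData FinQuiver in
/-- STATEMENT 17. -/
theorem Xi_isometry_and_equivariant (D : ConnData) :
    (∀ γ γ' : D.CIdx → ℤ,
      D.hatForm γ γ' = FinQuiver.bform D.quiv (D.XiMap γ) (D.XiMap γ')) ∧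
    (∀ (γ : D.CIdx → ℤ) (a : D.CIdx),
      D.XiMap (D.hatRefl a γ) = D.sDown a (D.XiMap γ)) := by
  refine ⟨D.hatForm_eq_quivForm_XiMap, fun γ a => ?_⟩
  rw [hatRefl, XiMap_sub_smul, hatForm_eq_quivForm_XiMap]
  rcases a with jj | a
  · rw [XiMap_hatGen_inl]
    rfl
  · rw [XiMap_hatGen_inr, ← eps_legV]
    rfl
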